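/- Fix 0 < ε ≤ 1/3. There exist constants C > 0 and λ₀ > 0, depending only on ε, such that for every λ ≥ λ₀ and every median z ∈ Z_λ with 0 < Δ(z) ≤ √λ, the number of medians w ∈ Z_λ with 0 < Δ(w) ≤ √λ and |z − w| < λ^ε is at most C·B_λ. -/

import Mathlib

open MeasureTheory Real

noncomputable section

/-- The Euclidean norm of a vector in `ℝ × ℝ`. -/
def e2 (x : ℝ × ℝ) : ℝ := Real.sqrt (x.1 ^ 2 + x.2 ^ 2)

/-- The integer vector `μ` viewed as a vector in `ℝ × ℝ`. -/
def iv (μ : ℤ × ℤ) : ℝ × ℝ := ((μ.1 : ℝ), (μ.2 : ℝ))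

/-- The set of lattice points on the circle of radius `lam`. -/
def Elat (lam : ℝ) : Finset (ℤ × ℤ) := by
  classical
  exact (Finset.Icc (-⌈lam⌉, -⌈lam⌉) (⌈lam⌉, ⌈lam⌉)).filter
    (fun μ => (μ.1 : ℝ) ^ 2 + (μ.2 : ℝ) ^ 2 = lam ^ 2)

/-- `B_lam`: the maximal number of lattice points on the circle of radius `lam`
lying in an arc of length `√lam`. -/
def Bmax (lam : ℝ) : ℕ := by
  classical
  exact sSup {n : ℕ | ∃ x : ℝ × ℝ, e2 x = lam ∧
    n = ((Elat lam).filter fun ξ => e2 (iv ξ - x) ≤ Real.sqrt lam).card}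

/-- `Z_lam`: the set of medians `(μ+ν)/2` of pairs of lattice points on the circle
of radius `lam`. -/
def Zmed (lam : ℝ) : Finset (ℝ × ℝ) := by
  classical
  exact ((Elat lam) ×ˢ (Elat lam)).image fun p => ((1:ℝ)/2) • (iv p.1 + iv p.2)

/-- `Δ(z) = √(lam² - |z|²)`, half the distance between the two points of the circle of
radius `lam` with midpoint `z`. -/
def Del (lam : ℝ) (z : ℝ × ℝ) : ℝ := Real.sqrt (lam ^ 2 - (e2 z) ^ 2)

/-- Rotation of a plane vector by `π/2`. -/
def perp (z : ℝ × ℝ) : ℝ × ℝ := (-z.2, z.1)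

/-- `μ₊(z) = z + Δ(z)·z^⊥/|z^⊥|`, one of the two points on the circle of radius `lam`
whose midpoint is `z`. -/
def mup (lam : ℝ) (z : ℝ × ℝ) : ℝ × ℝ := z + (Del lam z / e2 z) • perp z

/-- The number of medians `w ∈ Z_lam` with `0 < Δ(w) ≤ √lam` and `|z - w| < lam^ε`. -/
def nearMedCount (lam ε : ℝ) (z : ℝ × ℝ) : ℕ := by
  classical
  exact ((Zmed lam).filter fun w => 0 < Del lam w ∧ Del lam w ≤ Real.sqrt lam ∧
    e2 (z - w) < lam ^ ε).card

theorem e2_le_iff {x : ℝ × ℝ} {r : ℝ} (hr : 0 ≤ r) : e2 x ≤ r ↔ x.1 ^ 2 + x.2 ^ 2 ≤ r ^ 2 :=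
  Real.sqrt_le_left hr

theorem e2_sq (x : ℝ × ℝ) : e2 x ^ 2 = x.1 ^ 2 + x.2 ^ 2 :=
  Real.sq_sqrt (by positivity)

theorem mem_Elat_eq {lam : ℝ} {μ : ℤ × ℤ} (h : μ ∈ Elat lam) :
    (μ.1 : ℝ) ^ 2 + (μ.2 : ℝ) ^ 2 = lam ^ 2 := by
  classical
  unfold Elat at h
  exact (Finset.mem_filter.1 h).2

/-- Two reals with the same integer part after scaling by `2 / d` are within `d / 2`. -/
theorem sq_sub_le_of_floor_eq {a b d : ℝ} (hd : 0 < d)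
    (h : ⌊a * 2 / d⌋ = ⌊b * 2 / d⌋) : (a - b) ^ 2 ≤ d ^ 2 / 4 := by
  have h1 := Int.abs_sub_lt_one_of_floor_eq_floor h
  have h2 : a * 2 / d - b * 2 / d = (a - b) * 2 / d := by ring
  rw [h2, abs_lt, lt_div_iff₀ hd, div_lt_iff₀ hd] at h1
  nlinarith [h1.1, h1.2]

theorem floor_mem_Icc_of_sq_le {a d : ℝ} (hd : 0 < d) (h : a ^ 2 ≤ 4 * d ^ 2) :
    ⌊a * 2 / d⌋ ∈ Finset.Icc (-4 : ℤ) 4 := by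
  have h1 : |a| ≤ 2 * d := abs_le_of_sq_le_sq (by linarith) (by linarith)
  rw [abs_le] at h1
  rw [Finset.mem_Icc]
  constructor
  · rw [Int.le_floor, le_div_iff₀ hd]; push_cast; linarith
  · have h2 : a * 2 / d ≤ 4 := by rw [div_le_iff₀ hd]; linarith
    exact_mod_cast (Int.floor_le _).trans h2

/-- A set of integer points in a disc of radius `2 d`, all of whose subsets of diameter at most `d`
have at most `N` points, has at most `81 N` points. -/
theorem card_le_of_small_subsets {S : Finset (ℤ × ℤ)} {c : ℝ × ℝ} {d : ℝ} {N : ℕ} (hd : 0 < d)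
    (hS : ∀ p ∈ S, ((p.1 : ℝ) - c.1) ^ 2 + ((p.2 : ℝ) - c.2) ^ 2 ≤ 4 * d ^ 2)
    (hN : ∀ T ⊆ S, (∀ p ∈ T, ∀ q ∈ T,
      ((p.1 : ℝ) - q.1) ^ 2 + ((p.2 : ℝ) - q.2) ^ 2 ≤ d ^ 2) → T.card ≤ N) :
    S.card ≤ 81 * N := by
  classical
  let f : ℤ × ℤ → ℤ × ℤ := fun p => (⌊((p.1 : ℝ) - c.1) * 2 / d⌋, ⌊((p.2 : ℝ) - c.2) * 2 / d⌋)
  have hf : ∀ p ∈ S, f p ∈ Finset.Icc (-4 : ℤ) 4 ×ˢ Finset.Icc (-4 : ℤ) 4 := by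
    intro p hp
    have h := hS p hp
    exact Finset.mem_product.2
      ⟨floor_mem_Icc_of_sq_le hd (by nlinarith [sq_nonneg ((p.2 : ℝ) - c.2)]),
        floor_mem_Icc_of_sq_le hd (by nlinarith [sq_nonneg ((p.1 : ℝ) - c.1)])⟩
  have hcard := Finset.card_le_mul_card_image_of_maps_to hf N (by
    intro b _
    refine hN _ (Finset.filter_subset _ _) fun p hp q hq => ?_
    have hpq : f p = f q := (Finset.mem_filter.1 hp).2.trans (Finset.mem_filter.1 hq).2.symm
    have h1 := sq_sub_le_of_floor_eq hd (congrArg Prod.fst hpq)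
    have h2 := sq_sub_le_of_floor_eq hd (congrArg Prod.snd hpq)
    simp only [sub_sub_sub_cancel_right] at h1 h2
    nlinarith [sq_nonneg d])
  have h81 : (Finset.Icc (-4 : ℤ) 4 ×ˢ Finset.Icc (-4 : ℤ) 4).card = 81 := by decide
  rw [h81] at hcard
  linarith

/-- The circumradius formula `a² b² c² = 4 R² D²`, with `D` twice the area of the triangle. -/
theorem prod_sq_dist_eq_of_cocircular {R : Type*} [CommRing R]
    {n x₁ y₁ x₂ y₂ x₃ y₃ : R}
    (h₁ : x₁ ^ 2 + y₁ ^ 2 = n) (h₂ : x₂ ^ 2 + y₂ ^ 2 = n) (h₃ : x₃ ^ 2 + y₃ ^ 2 = n) :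
    ((x₁ - x₂) ^ 2 + (y₁ - y₂) ^ 2) * ((x₁ - x₃) ^ 2 + (y₁ - y₃) ^ 2)
        * ((x₂ - x₃) ^ 2 + (y₂ - y₃) ^ 2) =
      4 * n * ((x₂ - x₁) * (y₃ - y₁) - (x₃ - x₁) * (y₂ - y₁)) ^ 2 := by
  obtain ⟨u, rfl⟩ : ∃ u, x₂ = x₁ + u := ⟨x₂ - x₁, by ring⟩
  obtain ⟨v, rfl⟩ : ∃ v, y₂ = y₁ + v := ⟨y₂ - y₁, by ring⟩
  obtain ⟨s, rfl⟩ : ∃ s, x₃ = x₁ + s := ⟨x₃ - x₁, by ring⟩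
  obtain ⟨t, rfl⟩ : ∃ t, y₃ = y₁ + t := ⟨y₃ - y₁, by ring⟩
  have hu : u ^ 2 + v ^ 2 = -2 * (x₁ * u + y₁ * v) := by linear_combination h₂ - h₁
  have hs : s ^ 2 + t ^ 2 = -2 * (x₁ * s + y₁ * t) := by linear_combination h₃ - h₁
  have key : 4 * n * (u * t - s * v) ^ 2 =
      ((-2 * (x₁ * u + y₁ * v)) * s - (-2 * (x₁ * s + y₁ * t)) * u) ^ 2 +
      ((-2 * (x₁ * u + y₁ * v)) * t - (-2 * (x₁ * s + y₁ * t)) * v) ^ 2 := by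
    rw [← h₁]; ring
  rw [← hu, ← hs] at key
  linear_combination -key

theorem sq_dist_pos {p q : ℤ × ℤ} (h : p ≠ q) : 0 < (p.1 - q.1) ^ 2 + (p.2 - q.2) ^ 2 := by
  by_contra hle
  apply h
  have h1 : p.1 - q.1 = 0 := by nlinarith [sq_nonneg (p.1 - q.1), sq_nonneg (p.2 - q.2)]
  have h2 : p.2 - q.2 = 0 := by nlinarith [sq_nonneg (p.1 - q.1), sq_nonneg (p.2 - q.2)]
  exact Prod.ext (by linarith) (by linarith)

/-- Three distinct lattice points on a circle of radius `lam` with mutual distances at most `d`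
satisfy `4 lam² ≤ d⁶`. -/
theorem four_mul_sq_le_of_three_points {lam d : ℝ} {p q r : ℤ × ℤ}
    (hp : p ∈ Elat lam) (hq : q ∈ Elat lam) (hr : r ∈ Elat lam)
    (hpq : p ≠ q) (hpr : p ≠ r) (hqr : q ≠ r)
    (dpq : ((p.1 : ℝ) - q.1) ^ 2 + ((p.2 : ℝ) - q.2) ^ 2 ≤ d ^ 2)
    (dpr : ((p.1 : ℝ) - r.1) ^ 2 + ((p.2 : ℝ) - r.2) ^ 2 ≤ d ^ 2)
    (dqr : ((q.1 : ℝ) - r.1) ^ 2 + ((q.2 : ℝ) - r.2) ^ 2 ≤ d ^ 2) :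
    4 * lam ^ 2 ≤ d ^ 6 := by
  have key := prod_sq_dist_eq_of_cocircular (mem_Elat_eq hp) (mem_Elat_eq hq) (mem_Elat_eq hr)
  set D : ℤ := (q.1 - p.1) * (r.2 - p.2) - (r.1 - p.1) * (q.2 - p.2) with hD
  have hDcast : ((q.1 : ℝ) - p.1) * (r.2 - p.2) - (r.1 - p.1) * (q.2 - p.2) = (D : ℝ) := by
    rw [hD]; push_cast; ring
  rw [hDcast] at key
  have apq : 0 < ((p.1 : ℝ) - q.1) ^ 2 + ((p.2 : ℝ) - q.2) ^ 2 := by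
    exact_mod_cast sq_dist_pos hpq
  have apr : 0 < ((p.1 : ℝ) - r.1) ^ 2 + ((p.2 : ℝ) - r.2) ^ 2 := by
    exact_mod_cast sq_dist_pos hpr
  have aqr : 0 < ((q.1 : ℝ) - r.1) ^ 2 + ((q.2 : ℝ) - r.2) ^ 2 := by
    exact_mod_cast sq_dist_pos hqr
  have hprod := mul_pos (mul_pos apq apr) aqr
  have hD0 : D ≠ 0 := by
    intro h0
    rw [key, h0] at hprod
    simp at hprod
  have hD1 : (1 : ℝ) ≤ (D : ℝ) ^ 2 := by
    have : 1 ≤ D ^ 2 := Int.add_one_le_iff.2 (sq_pos_of_ne_zero hD0)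
    exact_mod_cast this
  calc 4 * lam ^ 2 ≤ 4 * lam ^ 2 * (D : ℝ) ^ 2 := le_mul_of_one_le_right (by positivity) hD1
    _ = _ := key.symm
    _ ≤ d ^ 2 * d ^ 2 * d ^ 2 := by gcongr
    _ = d ^ 6 := by ring

theorem card_filter_le_Bmax {lam : ℝ} {x : ℝ × ℝ} (hx : e2 x = lam)
    {T : Finset (ℤ × ℤ)} (hT : T ⊆ Elat lam) (hd : ∀ p ∈ T, e2 (iv p - x) ≤ √lam) :
    T.card ≤ Bmax lam := by
  classical
  unfold Bmax
  refine le_trans (Finset.card_le_card ?_) (le_csSup ?_ ⟨x, hx, rfl⟩)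
  · exact fun p hp => Finset.mem_filter.2 ⟨hT hp, hd p hp⟩
  · refine ⟨(Elat lam).card, ?_⟩
    rintro n ⟨y, -, rfl⟩
    exact Finset.card_filter_le _ _

/-- The lattice points on the circle of radius `lam` within `2 √lam` of a point number
at most `81 B_lam`. -/
theorem card_le_Bmax_of_near {lam : ℝ} (hlam : 0 < lam) {c : ℝ × ℝ}
    {S : Finset (ℤ × ℤ)} (hS : S ⊆ Elat lam)
    (hc : ∀ p ∈ S, ((p.1 : ℝ) - c.1) ^ 2 + ((p.2 : ℝ) - c.2) ^ 2 ≤ 4 * √lam ^ 2) :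
    S.card ≤ 81 * Bmax lam := by
  refine card_le_of_small_subsets (Real.sqrt_pos.2 hlam) hc fun T hT hdist => ?_
  rcases T.eq_empty_or_nonempty with rfl | ⟨q, hq⟩
  · simp
  · refine card_filter_le_Bmax (x := iv q) ?_ (hT.trans hS) fun p hp => ?_
    · have := mem_Elat_eq (hS (hT hq))
      simp only [e2, iv, this]
      exact Real.sqrt_sq hlam.le
    · exact (e2_le_iff (Real.sqrt_nonneg _)).2 (hdist p hp q hq)

/-- The lattice points on the circle of radius `d ^ 3` within `2 d` of a point number
at most `162`. -/
theorem card_le_of_near_cube_root {lam d : ℝ} (hd : 0 < d) (hlam : d ^ 3 = lam) {c : ℝ × ℝ}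
    {S : Finset (ℤ × ℤ)} (hS : S ⊆ Elat lam)
    (hc : ∀ p ∈ S, ((p.1 : ℝ) - c.1) ^ 2 + ((p.2 : ℝ) - c.2) ^ 2 ≤ 4 * d ^ 2) :
    S.card ≤ 162 := by
  refine card_le_of_small_subsets (N := 2) hd hc fun T hT hdist => ?_
  by_contra! h
  obtain ⟨p, q, r, hp, hq, hr, hpq, hpr, hqr⟩ := Finset.two_lt_card_iff.1 h
  have := four_mul_sq_le_of_three_points (hS (hT hp)) (hS (hT hq)) (hS (hT hr)) hpq hpr hqr
    (hdist p hp q hq) (hdist p hp r hr) (hdist q hq r hr)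
  have hpos : 0 < d ^ 6 := by positivity
  rw [← hlam] at this
  nlinarith

/-- If the midpoint `w` of `μ, ν ∈ E_lam` is within `√lam` of `z` and `Δ(w) ≤ √lam`, then `μ` is
within `2 √lam` of `z`. -/
theorem sq_dist_endpoint_le {lam : ℝ} {μ ν : ℤ × ℤ} (hμ : μ ∈ Elat lam) (hν : ν ∈ Elat lam)
    {z w : ℝ × ℝ} (hw : w = ((1:ℝ)/2) • (iv μ + iv ν)) (hΔ : Del lam w ≤ √lam)
    (hz : e2 (z - w) ≤ √lam) :
    ((μ.1 : ℝ) - z.1) ^ 2 + ((μ.2 : ℝ) - z.2) ^ 2 ≤ 4 * √lam ^ 2 := by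
  have h1 := mem_Elat_eq hμ
  have h2 := mem_Elat_eq hν
  have hw1 : w.1 = (μ.1 + ν.1) / 2 := by simp [hw, iv]; ring
  have hw2 : w.2 = (μ.2 + ν.2) / 2 := by simp [hw, iv]; ring
  rw [Del, Real.sqrt_le_left (Real.sqrt_nonneg _), e2_sq] at hΔ
  rw [e2_le_iff (Real.sqrt_nonneg _)] at hz
  simp only [Prod.fst_sub, Prod.snd_sub] at hz
  have h3 : ((μ.1 : ℝ) - w.1) ^ 2 + ((μ.2 : ℝ) - w.2) ^ 2 = lam ^ 2 - (w.1 ^ 2 + w.2 ^ 2) := by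
    rw [hw1, hw2]; linear_combination (1 / 2) * h1 + (1 / 2) * h2
  nlinarith [sq_nonneg ((μ.1 : ℝ) - w.1 - (w.1 - z.1)), sq_nonneg ((μ.2 : ℝ) - w.2 - (w.2 - z.2))]

/-- For a median `z ∈ Z_lam` with `0 < Δ(z) ≤ √lam`, the number of medians `w ∈ Z_lam` with
`0 < Δ(w) ≤ √lam` and `|z - w| < lam^ε` is `O(B_lam)`. -/
theorem count_close_small_Delta_medians
    (ε : ℝ) (hε0 : 0 < ε) (hε : ε ≤ 1/3) :
    ∃ C > (0:ℝ), ∃ lam0 > (0:ℝ), ∀ lam : ℝ, lam0 ≤ lam →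
      ∀ z ∈ Zmed lam, 0 < Del lam z → Del lam z ≤ Real.sqrt lam →
        (nearMedCount lam ε z : ℝ) ≤ C * (Bmax lam : ℝ) := by
  classical
  refine ⟨162 * 81, by norm_num, 1, one_pos, fun lam hlam z _ _ _ => ?_⟩
  have hpos : 0 < lam := by linarith
  set d : ℝ := lam ^ (1 / 3 : ℝ) with hd
  have hd0 : 0 < d := Real.rpow_pos_of_pos hpos _
  have hd3 : d ^ 3 = lam := by
    rw [hd, ← Real.rpow_natCast, ← Real.rpow_mul hpos.le]; norm_num
  have hεd : lam ^ ε ≤ d := Real.rpow_le_rpow_of_exponent_le hlam hε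
  have hds : d ≤ √lam := by
    rw [Real.sqrt_eq_rpow]
    exact Real.rpow_le_rpow_of_exponent_le hlam (by norm_num)
  set S := (Elat lam).filter fun μ =>
    ((μ.1 : ℝ) - z.1) ^ 2 + ((μ.2 : ℝ) - z.2) ^ 2 ≤ 4 * √lam ^ 2 with hS
  let F : ℤ × ℤ → Finset (ℤ × ℤ) := fun μ => (Elat lam).filter fun ν =>
    ((ν.1 : ℝ) - (2 * z.1 - μ.1)) ^ 2 + ((ν.2 : ℝ) - (2 * z.2 - μ.2)) ^ 2 ≤ 4 * d ^ 2
  have hScard : S.card ≤ 81 * Bmax lam :=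
    card_le_Bmax_of_near hpos (Finset.filter_subset _ _) fun p hp => (Finset.mem_filter.1 hp).2
  have hFcard : ∀ μ ∈ S, ((F μ).image fun ν => ((1:ℝ)/2) • (iv μ + iv ν)).card ≤ 162 :=
    fun μ _ => Finset.card_image_le.trans <|
      card_le_of_near_cube_root (c := (2 * z.1 - μ.1, 2 * z.2 - μ.2)) hd0 hd3
        (Finset.filter_subset _ _) fun p hp => (Finset.mem_filter.1 hp).2
  have hcount : nearMedCount lam ε z ≤ S.card * 162 := by
    unfold nearMedCount
    refine le_trans (Finset.card_le_card ?_) (Finset.card_biUnion_le_card_mul S _ 162 hFcard)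
    intro w hw
    obtain ⟨hwZ, -, hΔ, hzw⟩ := Finset.mem_filter.1 hw
    unfold Zmed at hwZ
    obtain ⟨⟨μ, ν⟩, hμν, hw'⟩ := Finset.mem_image.1 hwZ
    obtain ⟨hμ, hν⟩ := Finset.mem_product.1 hμν
    have hzd : e2 (z - w) ≤ d := hzw.le.trans hεd
    refine Finset.mem_biUnion.2 ⟨μ, Finset.mem_filter.2
      ⟨hμ, sq_dist_endpoint_le hμ hν hw'.symm hΔ (hzd.trans hds)⟩,
      Finset.mem_image.2 ⟨ν, Finset.mem_filter.2 ⟨hν, ?_⟩, hw'⟩⟩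
    rw [e2_le_iff hd0.le, ← hw'] at hzd
    simp [iv] at hzd
    nlinarith
  have : nearMedCount lam ε z ≤ 162 * 81 * Bmax lam := by linarith
  exact_mod_cast this
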